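/- Let C ⊆ ℝ^n be a polytope (the convex hull of a finite set), f : C × C → ℝ an equilibrium bifunction, K : C ⇉ C lower semicontinuous with nonempty convex values and fix K closed, and F(x) := {y ∈ C : f(x,y) < 0}. Assume: (i) F(x) is convex for every x ∈ fix K; (ii) F has open lower sections on fix K, i.e. for every y ∈ C the set F⁻¹(y) := {x ∈ C : y ∈ F(x)} is open in the relative topology of fix K; (iii) F(x) is open in the relative topology of C for every x ∈ ∂_C fix K. Then the quasiequilibrium problem has a solution: there exists x ∈ K(x) with f(x,y) ≥ 0 for all y ∈ K(x). -/

import Mathlib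

open Set Topology Filter

/-- A set-valued map `Φ : X ⇉ Y` is lower semicontinuous at `x` if for every open set `Ω`
with `Φ x ∩ Ω ≠ ∅` there is a neighborhood of `x` on which `Φ x' ∩ Ω ≠ ∅`. -/
def LscAt {X Y : Type*} [TopologicalSpace X] [TopologicalSpace Y]
    (Φ : X → Set Y) (x : X) : Prop :=
  ∀ Ω : Set Y, IsOpen Ω → (Φ x ∩ Ω).Nonempty → ∀ᶠ x' in 𝓝 x, (Φ x' ∩ Ω).Nonempty

/-! ### Scarf's combinatorial lemma -/

section Scarf

variable {X I L : Type*} [LinearOrder L]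

/-- A finite set `S` is *dominating* for the family of preorders `r` if no point is strictly above
the minimum of `S` in each of them. -/
def IsDominating (r : I → X → L) (S : Finset X) : Prop :=
  ∀ t, ∃ i, ∀ s ∈ S, r i t ≤ r i s

/-- `m i` is a minimum of `S` for the preorder `r i`. -/
def IsMinFamily (r : I → X → L) (S : Finset X) (m : I → X) : Prop :=
  ∀ i, m i ∈ S ∧ ∀ s ∈ S, r i (m i) ≤ r i s

/-- Among the points above `m l` in all preorders `r l`, `l ≠ k`, the point `t` is highest
for `r k`. -/
def IsPivot (r : I → X → L) (m : I → X) (k : I) (t : X) : Prop :=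
  (∀ l, l ≠ k → r l (m l) < r l t) ∧ ∀ u, (∀ l, l ≠ k → r l (m l) < r l u) → r k u ≤ r k t

theorem exists_isMinFamily (r : I → X → L) {S : Finset X} (hS : S.Nonempty) :
    ∃ m, IsMinFamily r S m := by
  choose m hm using fun i => S.exists_min_image (r i) hS
  exact ⟨m, hm⟩

theorem exists_isPivot [Finite X] {r : I → X → L} {m : I → X} {k : I} {x : X}
    (hx : ∀ l, l ≠ k → r l (m l) < r l x) : ∃ t, IsPivot r m k t := by
  obtain ⟨t, ht, ht'⟩ := Set.exists_max_image {u | ∀ l, l ≠ k → r l (m l) < r l u} (r k)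
    (Set.toFinite _) ⟨x, hx⟩
  exact ⟨t, ht, ht'⟩

theorem IsPivot.unique {r : I → X → L} (hr : ∀ i, Function.Injective (r i)) {m : I → X} {k : I}
    {t u : X} (ht : IsPivot r m k t) (hu : IsPivot r m k u) : t = u :=
  hr k (le_antisymm (hu.2 t ht.1) (ht.2 u hu.1))

theorem IsDominating.mono {r : I → X → L} {S T : Finset X} (hT : IsDominating r T) (h : S ⊆ T) :
    IsDominating r S := fun t => (hT t).imp fun _ hi s hs => hi s (h hs)

section

variable {r : I → X → L} {S : Finset X} {m : I → X}

theorem IsDominating.surjOn (hr : ∀ i, Function.Injective (r i)) (hS : IsDominating r S)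
    (hm : IsMinFamily r S m) {s : X} (hs : s ∈ S) : ∃ i, m i = s := by
  obtain ⟨i, hi⟩ := hS s
  exact ⟨i, hr i (le_antisymm ((hm i).2 s hs) (hi _ (hm i).1))⟩

theorem IsDominating.injective_of_card [Fintype I] (hr : ∀ i, Function.Injective (r i))
    (hS : IsDominating r S) (hm : IsMinFamily r S m) (hc : S.card = Fintype.card I) :
    Function.Injective m := by
  have := Finset.injOn_of_surjOn_of_card_le (s := Finset.univ) (t := S) m
    (fun i _ => (hm i).1) (fun s hs => by
      obtain ⟨i, hi⟩ := hS.surjOn hr hm hs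
      exact ⟨i, by simp, hi⟩) (by simp [hc])
  intro a b h
  exact this (by simp) (by simp) h

theorem IsDominating.exists_eq_of_card [Fintype I] (hm : IsMinFamily r S m)
    (hc : S.card + 1 = Fintype.card I) : ∃ i j, i ≠ j ∧ m i = m j := by
  obtain ⟨i, -, j, -, hij, h⟩ := Finset.exists_ne_map_eq_of_card_lt_of_maps_to
    (s := Finset.univ) (t := S) (f := m) (by simp [← hc]) (fun i _ => (hm i).1)
  exact ⟨i, j, hij, h⟩

theorem IsPivot.le (hS : IsDominating r S) (hm : IsMinFamily r S m) {k : I} {t : X}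
    (ht : IsPivot r m k t) {s : X} (hs : s ∈ S) : r k t ≤ r k s := by
  obtain ⟨l, hl⟩ := hS t
  by_cases hlk : l = k
  · exact hlk ▸ hl s hs
  · exact absurd (ht.1 l hlk) (not_lt.2 (hl _ (hm l).1))

theorem IsPivot.notMem (hr : ∀ i, Function.Injective (r i)) (hS : IsDominating r S)
    (hm : IsMinFamily r S m) {i j : I} (hij : i ≠ j) (h : m i = m j) {t : X}
    (ht : IsPivot r m i t) : t ∉ S := by
  intro hts
  obtain ⟨l, hl⟩ := hS.surjOn hr hm hts
  by_cases hli : l = i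
  · subst hli
    refine absurd (ht.1 j hij.symm) ?_
    rw [← h, hl]
    exact lt_irrefl _
  · exact absurd (ht.1 l hli) (by rw [hl]; exact lt_irrefl _)

theorem IsPivot.not_isPivot (hS : IsDominating r S) (hm : IsMinFamily r S m) {i j : I}
    (hij : i ≠ j) {t u : X} (ht : IsPivot r m i t) (hu : IsPivot r m j u) : t ≠ u := by
  rintro rfl
  exact absurd (hu.1 i hij) (not_lt.2 (ht.le hS hm (hm i).1))

variable [DecidableEq X]

theorem IsPivot.isDominating_insert (hS : IsDominating r S) (hm : IsMinFamily r S m) {k : I}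
    {t : X} (ht : IsPivot r m k t) : IsDominating r (insert t S) := by
  intro u
  by_cases hu : ∀ l, l ≠ k → r l (m l) < r l u
  · refine ⟨k, fun s hs => (ht.2 u hu).trans ?_⟩
    rcases Finset.mem_insert.1 hs with rfl | hs
    · exact le_rfl
    · exact ht.le hS hm hs
  · push Not at hu
    obtain ⟨l, hlk, hl⟩ := hu
    refine ⟨l, fun s hs => hl.trans ?_⟩
    rcases Finset.mem_insert.1 hs with rfl | hs
    · exact (ht.1 l hlk).le
    · exact (hm l).2 s hs

theorem IsDominating.isPivot_or [Fintype I] (hr : ∀ i, Function.Injective (r i))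
    (hm : IsMinFamily r S m)
    (hc : S.card + 1 = Fintype.card I) {i j : I} (hij : i ≠ j) (h : m i = m j) {t : X}
    (ht : t ∉ S) (hT : IsDominating r (insert t S)) : IsPivot r m i t ∨ IsPivot r m j t := by
  obtain ⟨m', hm'⟩ := exists_isMinFamily r (Finset.insert_nonempty t S)
  have hinj := hT.injective_of_card hr hm' (by rw [Finset.card_insert_of_notMem ht, hc])
  obtain ⟨k, hk⟩ := hT.surjOn hr hm' (Finset.mem_insert_self t S)
  have hne : ∀ l, l ≠ k → m' l ≠ t := fun l hl e => hl (hinj (e.trans hk.symm))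
  have hmem : ∀ l, l ≠ k → m' l ∈ S := fun l hl =>
    (Finset.mem_insert.1 (hm' l).1).resolve_left (hne l hl)
  have heq : ∀ l, l ≠ k → m' l = m l := fun l hl =>
    hr l (le_antisymm ((hm' l).2 _ (Finset.mem_insert_of_mem (hm l).1)) ((hm l).2 _ (hmem l hl)))
  have hp : IsPivot r m k t := by
    have hlt : ∀ l, l ≠ k → r l (m l) < r l t := fun l hl => by
      rw [← heq l hl]
      exact lt_of_le_of_ne ((hm' l).2 t (Finset.mem_insert_self t S)) fun e => hne l hl (hr l e)
    refine ⟨hlt, fun u hu => ?_⟩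
    obtain ⟨l, hl⟩ := hT u
    by_cases hlk : l = k
    · exact hlk ▸ hl t (Finset.mem_insert_self t S)
    · exact absurd (hu l hlk) (not_lt.2 (hl _ (Finset.mem_insert_of_mem (hm l).1)))
  by_cases hik : i = k
  · exact Or.inl (hik ▸ hp)
  by_cases hjk : j = k
  · exact Or.inr (hjk ▸ hp)
  · exact absurd (hinj (((heq i hik).trans h).trans (heq j hjk).symm)) hij

end

/-- The data of Scarf's lemma: injective rankings `r i` of a set containing a slack point `e i`
for each `i`, which is lowest for `r i` and higher than all non-slack points for the others. -/
structure IsScarfSystem (r : I → X → L) (e : I → X) : Prop where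
  injective : ∀ i, Function.Injective (r i)
  slack_le : ∀ i x, r i (e i) ≤ r i x
  lt_slack : ∀ i j x, j ≠ i → x ∉ Set.range e → r i x < r i (e j)

variable {r : I → X → L} {e : I → X} {c : X → I}

theorem IsScarfSystem.exists_isPivot [Finite X] (h : IsScarfSystem r e)
    (he : Function.Injective e) {S : Finset X} {m : I → X} (hm : IsMinFamily r S m)
    (hS : ∃ s ∈ S, s ∉ Set.range e) (i : I) : ∃ t, IsPivot r m i t := by
  refine _root_.exists_isPivot (x := e i) fun k hk => ?_
  by_contra hlt
  rw [not_lt] at hlt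
  by_cases hmk : m k ∈ Set.range e
  · obtain ⟨l, hl⟩ := hmk
    rw [← hl] at hlt
    by_cases hlk : l = k
    · subst hlk
      exact hk (he (h.injective _ (le_antisymm (h.slack_le _ _) hlt)))
    · obtain ⟨s, hs, hse⟩ := hS
      exact absurd (h.lt_slack k l s hlk hse) (not_lt.2 (hl ▸ (hm k).2 s hs))
  · exact absurd (h.lt_slack k i _ hk.symm hmk) (not_lt.2 hlt)

variable [Fintype X] [DecidableEq X] [Fintype I]

open Classical in
/-- A nonslack door belongs to an even number of rooms. -/
theorem IsScarfSystem.even_card_rooms (h : IsScarfSystem r e) (he : Function.Injective e)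
    {D : Finset X} (hD : D.card + 1 = Fintype.card I) (hDe : ∃ s ∈ D, s ∉ Set.range e) :
    Even (Finset.univ.filter fun R : Finset X =>
      (R.card = Fintype.card I ∧ IsDominating r R) ∧ D ⊆ R).card := by
  by_cases hdom : IsDominating r D
  · obtain ⟨m, hm⟩ := exists_isMinFamily r (hDe.imp fun _ => And.left)
    obtain ⟨i, j, hij, hmij⟩ := IsDominating.exists_eq_of_card hm hD
    obtain ⟨t, ht⟩ := h.exists_isPivot he hm hDe i
    obtain ⟨u, hu⟩ := h.exists_isPivot he hm hDe j
    have htD := ht.notMem h.injective hdom hm hij hmij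
    have huD := hu.notMem h.injective hdom hm hij.symm hmij.symm
    have htu := ht.not_isPivot hdom hm hij hu
    have : (Finset.univ.filter fun R : Finset X =>
        (R.card = Fintype.card I ∧ IsDominating r R) ∧ D ⊆ R) = {insert t D, insert u D} := by
      ext R
      simp only [Finset.mem_filter, Finset.mem_univ, true_and, Finset.mem_insert,
        Finset.mem_singleton]
      constructor
      · rintro ⟨⟨hRc, hR⟩, hDR⟩
        obtain ⟨v, hv, rfl⟩ := (Finset.covBy_iff_exists_insert (s := D) (t := R)).1
          (Finset.covBy_iff_card_sdiff_eq_one.2 ⟨hDR, by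
            rw [Finset.card_sdiff_of_subset hDR]; omega⟩)
        rcases hR.isPivot_or h.injective hm hD hij hmij hv with hv | hv
        · exact Or.inl (by rw [hv.unique h.injective ht])
        · exact Or.inr (by rw [hv.unique h.injective hu])
      · rintro (rfl | rfl)
        · exact ⟨⟨by rw [Finset.card_insert_of_notMem htD, hD], ht.isDominating_insert hdom hm⟩,
            Finset.subset_insert _ _⟩
        · exact ⟨⟨by rw [Finset.card_insert_of_notMem huD, hD], hu.isDominating_insert hdom hm⟩,
            Finset.subset_insert _ _⟩
    rw [this, Finset.card_pair]
    · exact even_two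
    · intro heq
      have : t ∈ insert u D := heq ▸ Finset.mem_insert_self t D
      exact (Finset.mem_insert.1 this).elim htu htD
  · rw [Finset.card_eq_zero.2]
    · exact Even.zero
    · refine Finset.filter_eq_empty_iff.2 fun R _ hR => hdom (hR.1.2.mono hR.2)

variable [DecidableEq I]

open Classical in
/-- The slack door belongs to exactly one room. -/
theorem IsScarfSystem.card_rooms_slack [Nontrivial I] (h : IsScarfSystem r e)
    (he : Function.Injective e) (i₀ : I) :
    (Finset.univ.filter fun R : Finset X =>
      (R.card = Fintype.card I ∧ IsDominating r R) ∧
        (Finset.univ.erase i₀).image e ⊆ R).card = 1 := by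
  set D := (Finset.univ.erase i₀).image e with hDdef
  have hmemD : ∀ {k}, k ≠ i₀ → e k ∈ D := fun {k} hk =>
    Finset.mem_image_of_mem _ (Finset.mem_erase.2 ⟨hk, Finset.mem_univ _⟩)
  have hD : D.card + 1 = Fintype.card I := by
    rw [hDdef, Finset.card_image_of_injective _ he, Finset.card_erase_of_mem (Finset.mem_univ _),
      Finset.card_univ]
    have := Fintype.card_pos (α := I)
    omega
  obtain ⟨k₀, hk₀⟩ := exists_ne i₀
  have hdom : IsDominating r D := by
    intro t
    by_cases ht : t ∈ Set.range e
    · obtain ⟨k, rfl⟩ := ht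
      exact ⟨k, fun s _ => h.slack_le k s⟩
    · refine ⟨i₀, fun s hs => ?_⟩
      obtain ⟨k, hk, rfl⟩ := Finset.mem_image.1 hs
      exact (h.lt_slack i₀ k t (Finset.mem_erase.1 hk).1 ht).le
  obtain ⟨m, hm⟩ := exists_isMinFamily r ⟨_, hmemD hk₀⟩
  have hmk : ∀ k, k ≠ i₀ → m k = e k := fun k hk =>
    h.injective k (le_antisymm ((hm k).2 _ (hmemD hk)) (h.slack_le _ _))
  obtain ⟨l, hl, hml⟩ := Finset.mem_image.1 (hm i₀).1
  have hl : l ≠ i₀ := (Finset.mem_erase.1 hl).1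
  have hmij : m i₀ = m l := by rw [hmk l hl, hml]
  obtain ⟨t, ht⟩ : ∃ t, IsPivot r m i₀ t := _root_.exists_isPivot (x := e i₀) fun k hk => by
    rw [hmk k hk]
    exact lt_of_le_of_ne (h.slack_le _ _) fun heq => hk (he (h.injective k heq))
  have htD := ht.notMem h.injective hdom hm hl.symm hmij
  have hnot : ∀ u, ¬ IsPivot r m l u := by
    intro u hu
    have h0 := hu.1 i₀ hl.symm
    rw [← hml] at h0
    by_cases hue : u ∈ Set.range e
    · obtain ⟨q, rfl⟩ := hue
      by_cases hq : q = i₀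
      · subst hq
        exact absurd h0 (not_lt.2 (h.slack_le _ _))
      by_cases hql : q = l
      · subst hql
        exact lt_irrefl _ h0
      · have := hu.1 q hql
        rw [hmk q hq] at this
        exact lt_irrefl _ this
    · exact lt_asymm h0 (h.lt_slack i₀ l u hl hue)
  rw [Finset.card_eq_one]
  refine ⟨insert t D, ?_⟩
  ext R
  simp only [Finset.mem_filter, Finset.mem_univ, true_and, Finset.mem_singleton]
  constructor
  · rintro ⟨⟨hRc, hR⟩, hDR⟩
    obtain ⟨v, hv, rfl⟩ := (Finset.covBy_iff_exists_insert (s := D) (t := R)).1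
      (Finset.covBy_iff_card_sdiff_eq_one.2 ⟨hDR, by
        rw [Finset.card_sdiff_of_subset hDR]; omega⟩)
    rcases hR.isPivot_or h.injective hm hD hl.symm hmij hv with hv | hv
    · rw [hv.unique h.injective ht]
    · exact absurd hv (hnot v)
  · rintro rfl
    exact ⟨⟨by rw [Finset.card_insert_of_notMem htD, hD], ht.isDominating_insert hdom hm⟩,
      Finset.subset_insert _ _⟩

/-- A room that does not receive all colours has an even number of doors receiving all colours
but `i₀`. -/
theorem even_card_doors {R : Finset X} (hRc : R.card = Fintype.card I) (i₀ : I)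
    (hR : R.image c ≠ Finset.univ) :
    Even (Finset.univ.filter fun D : Finset X =>
      (D.card + 1 = Fintype.card I ∧ D.image c = Finset.univ.erase i₀) ∧ D ⊆ R).card := by
  rcases Finset.eq_empty_or_nonempty (Finset.univ.filter fun D : Finset X =>
      (D.card + 1 = Fintype.card I ∧ D.image c = Finset.univ.erase i₀) ∧ D ⊆ R) with h0 | ⟨D, hD⟩
  · rw [h0]; exact Even.zero
  simp only [Finset.mem_filter, Finset.mem_univ, true_and] at hD
  obtain ⟨⟨hDc, hDi⟩, hDR⟩ := hD
  obtain ⟨x, hx, rfl⟩ := (Finset.covBy_iff_exists_insert (s := D) (t := R)).1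
    (Finset.covBy_iff_card_sdiff_eq_one.2 ⟨hDR, by
      rw [Finset.card_sdiff_of_subset hDR]; omega⟩)
  have hinj : Set.InjOn c D := Finset.card_image_iff.1 (by
    rw [hDi, Finset.card_erase_of_mem (Finset.mem_univ _), Finset.card_univ]; omega)
  have hcx : c x ∈ D.image c := by
    rw [hDi, Finset.mem_erase]
    refine ⟨fun hx0 => hR ?_, Finset.mem_univ _⟩
    rw [Finset.image_insert, hDi, hx0, Finset.insert_erase (Finset.mem_univ _)]
  obtain ⟨y, hy, hyx⟩ := Finset.mem_image.1 hcx
  have hxy : x ≠ y := fun h => hx (h ▸ hy)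
  have : (Finset.univ.filter fun D' : Finset X =>
      (D'.card + 1 = Fintype.card I ∧ D'.image c = Finset.univ.erase i₀) ∧ D' ⊆ insert x D)
      = {D, (insert x D).erase y} := by
    ext D'
    simp only [Finset.mem_filter, Finset.mem_univ, true_and, Finset.mem_insert,
      Finset.mem_singleton]
    constructor
    · rintro ⟨⟨hc', hi'⟩, hsub⟩
      obtain ⟨z, hz, hzR⟩ := (Finset.covBy_iff_exists_insert (s := D') (t := insert x D)).1
        (Finset.covBy_iff_card_sdiff_eq_one.2 ⟨hsub, by
          rw [Finset.card_sdiff_of_subset hsub]; omega⟩)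
      have hD' : D' = (insert x D).erase z := by rw [← hzR, Finset.erase_insert hz]
      have hzmem : z ∈ insert x D := hzR ▸ Finset.mem_insert_self z D'
      rcases Finset.mem_insert.1 hzmem with rfl | hzD
      · left; rw [hD', Finset.erase_insert hx]
      · right
        have : c z ∈ D'.image c := by
          rw [hi', ← hDi]; exact Finset.mem_image_of_mem _ hzD
        obtain ⟨w, hw, hwz⟩ := Finset.mem_image.1 this
        have hwne : w ≠ z := fun h => hz (h ▸ hw)
        rcases Finset.mem_insert.1 (hsub hw) with rfl | hwD
        · rw [hD', hinj hzD hy (hwz.symm.trans hyx.symm)]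
        · exact absurd (hinj hwD hzD hwz) hwne
    · rintro (rfl | rfl)
      · exact ⟨⟨hDc, hDi⟩, Finset.subset_insert _ _⟩
      · refine ⟨⟨?_, ?_⟩, Finset.erase_subset _ _⟩
        · rw [Finset.card_erase_of_mem (Finset.mem_insert_of_mem hy),
            Finset.card_insert_of_notMem hx]; omega
        · rw [Finset.erase_insert_of_ne hxy, Finset.image_insert, ← hyx, ← Finset.image_insert,
            Finset.insert_erase hy, hDi]
  rw [this, Finset.card_pair]
  · exact even_two
  · intro heq
    rw [heq] at hy
    exact Finset.notMem_erase y _ hy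

/-- **Scarf's lemma**: some dominating set of `|I|` points receives every colour. -/
theorem IsScarfSystem.exists_colorful [Nontrivial I] (h : IsScarfSystem r e)
    (hc : ∀ i, c (e i) = i) :
    ∃ R : Finset X, R.card = Fintype.card I ∧ IsDominating r R ∧ R.image c = Finset.univ := by
  classical
  have he : Function.Injective e := Function.LeftInverse.injective hc
  by_contra! hno
  obtain ⟨i₀⟩ := (inferInstance : Nonempty I)
  set rooms : Finset (Finset X) :=
    Finset.univ.filter fun R => R.card = Fintype.card I ∧ IsDominating r R with hrooms
  set doors : Finset (Finset X) :=
    Finset.univ.filter fun D => D.card + 1 = Fintype.card I ∧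
      D.image c = Finset.univ.erase i₀ with hdoors
  have hcount := Finset.sum_card_bipartiteAbove_eq_sum_card_bipartiteBelow
    (s := doors) (t := rooms) (fun D R => D ⊆ R)
  have heven : Even (∑ R ∈ rooms, (doors.bipartiteBelow (fun D R => D ⊆ R) R).card) := by
    refine Finset.even_sum _ fun R hR => ?_
    have hR := (Finset.mem_filter.1 hR).2
    have := even_card_doors hR.1 i₀ (hno R hR.1 hR.2)
    rwa [Finset.bipartiteBelow, hdoors, Finset.filter_filter]
  set D₀ := (Finset.univ.erase i₀).image e with hD₀
  have hD₀i : D₀.image c = Finset.univ.erase i₀ := by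
    rw [hD₀, Finset.image_image, show c ∘ e = id from funext hc, Finset.image_id]
  have hmem : D₀ ∈ doors := by
    refine Finset.mem_filter.2 ⟨Finset.mem_univ _, ?_, hD₀i⟩
    rw [hD₀, Finset.card_image_of_injective _ he, Finset.card_erase_of_mem (Finset.mem_univ _),
      Finset.card_univ]
    have := Fintype.card_pos (α := I)
    omega
  have hodd : Odd (∑ D ∈ doors, (rooms.bipartiteAbove (fun D R => D ⊆ R) D).card) := by
    rw [← Finset.add_sum_erase _ _ hmem]
    refine Odd.add_even ?_ (Finset.even_sum _ fun D hD => ?_)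
    · rw [Finset.bipartiteAbove, hrooms, Finset.filter_filter, h.card_rooms_slack he i₀]
      exact odd_one
    · obtain ⟨hne, hD⟩ := Finset.mem_erase.1 hD
      obtain ⟨hDc, hDi⟩ := (Finset.mem_filter.1 hD).2
      rw [Finset.bipartiteAbove, hrooms, Finset.filter_filter]
      refine h.even_card_rooms he hDc ?_
      by_contra! hall
      refine hne ?_
      rw [hD₀, ← hDi, Finset.image_image]
      symm
      refine (Finset.image_congr fun x hx => ?_).trans Finset.image_id
      obtain ⟨k, rfl⟩ := hall x hx
      simp [hc]
  rw [hcount] at hodd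
  exact Nat.not_even_iff_odd.2 hodd heven

end Scarf

/-! ### Brouwer's fixed point theorem -/

section Brouwer

/-- Sperner-type lemma for the integer points of the simplex of size `N`. -/
theorem exists_rainbow_close {ι : Type*} [Fintype ι] [Nontrivial ι] (N : ℕ)
    (κ : (ι → ℕ) → ι) :
    ∃ (C : Finset ι) (x : ι → ι → ℕ), C.Nonempty ∧ ∀ i ∈ C, ∑ j, x i j = N ∧ κ (x i) = i ∧
      (∀ j ∉ C, x i j ≤ Fintype.card ι) ∧ ∀ k ∈ C, ∀ j, x i j ≤ x k j + Fintype.card ι := by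
  classical
  let T := {a : ι → Fin (N + 1) // ∑ i, (a i : ℕ) = N}
  let v : T ⊕ ι → ι → ℕ :=
    Sum.elim (fun a k => (a.1 k : ℕ) + 1) (fun j k => if k = j then 0 else N + 2)
  let enc : T ⊕ ι ≃ Fin (Fintype.card (T ⊕ ι)) := Fintype.equivFin _
  let r : ι → T ⊕ ι → ℕ ×ₗ Fin (Fintype.card (T ⊕ ι)) := fun i x => toLex (v x i, enc x)
  have hle : ∀ {i x y}, r i x ≤ r i y → v x i ≤ v y i := fun {i x y} h => by
    rcases Prod.Lex.toLex_le_toLex.1 h with h | h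
    · exact h.le
    · exact h.1.le
  have hlt : ∀ {i x y}, v x i < v y i → r i x < r i y := fun {i x y} h =>
    Prod.Lex.toLex_lt_toLex.2 (Or.inl h)
  have hr : IsScarfSystem r (Sum.inr : ι → T ⊕ ι) := by
    refine ⟨fun i x y h => ?_, fun i x => ?_, fun i j x hij hx => ?_⟩
    · exact enc.injective (congrArg (fun p => (ofLex p).2) h)
    · rcases eq_or_ne x (Sum.inr i) with rfl | hx
      · exact le_rfl
      · refine (hlt ?_).le
        rcases x with a | j
        · simp [v]
        · have : i ≠ j := fun h => hx (by rw [h])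
          simp [v, this]
    · rcases x with a | k
      · refine hlt ?_
        have := (a.1 i).2
        simp [v, hij.symm]
        omega
      · exact absurd ⟨k, rfl⟩ hx
  obtain ⟨R, hRc, hR, hRi⟩ := hr.exists_colorful
    (c := Sum.elim (fun a : T => κ fun i => a.1 i) id) (fun i => rfl)
  set C : Finset ι := Finset.univ.filter fun i => (Sum.inr i : T ⊕ ι) ∉ R with hC
  have hmemC : ∀ {i}, i ∈ C ↔ (Sum.inr i : T ⊕ ι) ∉ R := by simp [hC]
  have hx : ∀ i, i ∈ C → ∃ a : T, Sum.inl a ∈ R ∧ (κ fun k => a.1 k) = i := by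
    intro i hi
    have : i ∈ R.image (Sum.elim (fun a : T => κ fun i => a.1 i) id) := by
      rw [hRi]
      exact Finset.mem_univ i
    obtain ⟨a | j, ha, hai⟩ := Finset.mem_image.1 this
    · exact ⟨a, ha, hai⟩
    · simp only [Sum.elim_inr, id] at hai
      subst hai
      exact absurd ha (hmemC.1 hi)
  have hkey : ∀ t : ι → ℕ, ∑ i, t i = N →
      ∃ i ∈ C, ∀ a : T, Sum.inl a ∈ R → t i ≤ a.1 i := by
    intro t ht
    have htN : ∀ i, t i < N + 1 := fun i => by
      have := Finset.single_le_sum (f := t) (fun _ _ => Nat.zero_le _) (Finset.mem_univ i)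
      omega
    obtain ⟨i, hi⟩ := hR (Sum.inl ⟨fun i => ⟨t i, htN i⟩, ht⟩)
    refine ⟨i, hmemC.2 fun hiR => ?_, fun a ha => ?_⟩
    · have := hle (hi _ hiR)
      simp [v] at this
    · have := hle (hi _ ha)
      simpa [v] using this
  obtain ⟨i₀⟩ := (inferInstance : Nonempty ι)
  have hCne : C.Nonempty := by
    obtain ⟨i, hi, -⟩ := hkey (Pi.single i₀ N) (by simp)
    exact ⟨i, hi⟩
  obtain ⟨a₀, ha₀, -⟩ := hx _ hCne.choose_spec
  have hμ : ∀ k, ∃ b : T, Sum.inl b ∈ R ∧ ∀ a : T, Sum.inl a ∈ R → b.1 k ≤ a.1 k := fun k => by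
    obtain ⟨b, hb, hb'⟩ := Set.exists_min_image {a : T | Sum.inl a ∈ R} (fun a => a.1 k)
      (Set.toFinite _) ⟨a₀, ha₀⟩
    exact ⟨b, hb, hb'⟩
  choose b hb hbmin using hμ
  have hsum : N < ∑ k ∈ C, ((b k).1 k + 1 : ℕ) := by
    by_contra! hle
    obtain ⟨i, hi, hmin⟩ := hkey (fun k => (if k ∈ C then ((b k).1 k + 1 : ℕ) else 0) +
      if k = i₀ then N - ∑ k ∈ C, ((b k).1 k + 1 : ℕ) else 0) (by
        rw [Finset.sum_add_distrib, Finset.sum_ite_mem, Finset.univ_inter]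
        simp only [Finset.sum_ite_eq', Finset.mem_univ, if_true]
        omega)
    have := hmin _ (hb i)
    simp only [hi, if_true] at this
    omega
  have hcard : C.card ≤ Fintype.card ι := Finset.card_le_univ C
  rw [Finset.sum_add_distrib, Finset.sum_const, smul_eq_mul, mul_one] at hsum
  have hout : ∀ a : T, Sum.inl a ∈ R → ∀ j ∉ C, (a.1 j : ℕ) ≤ Fintype.card ι := by
    intro a ha j hj
    have h1 : ∑ k ∈ insert j C, (a.1 k : ℕ) ≤ N :=
      (Finset.sum_le_univ_sum_of_nonneg fun _ => Nat.zero_le _).trans a.2.le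
    rw [Finset.sum_insert hj] at h1
    have h2 : ∑ k ∈ C, ((b k).1 k : ℕ) ≤ ∑ k ∈ C, (a.1 k : ℕ) :=
      Finset.sum_le_sum fun k _ => hbmin k a ha
    omega
  have hin : ∀ a : T, Sum.inl a ∈ R → ∀ j ∈ C, (a.1 j : ℕ) ≤ (b j).1 j + Fintype.card ι := by
    intro a ha j hj
    have h1 : ∑ k ∈ C, (a.1 k : ℕ) ≤ N :=
      (Finset.sum_le_univ_sum_of_nonneg fun _ => Nat.zero_le _).trans a.2.le
    have h2 : ∑ k ∈ C.erase j, ((b k).1 k : ℕ) ≤ ∑ k ∈ C.erase j, (a.1 k : ℕ) :=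
      Finset.sum_le_sum fun k _ => hbmin k a ha
    rw [← Finset.add_sum_erase _ _ hj] at h1 hsum
    omega
  have : Nonempty T := ⟨a₀⟩
  choose! x hxR hxκ using hx
  refine ⟨C, fun i k => (x i).1 k, hCne, fun i hi => ⟨(x i).2, hxκ i hi, hout _ (hxR i hi),
    fun k hk j => ?_⟩⟩
  by_cases hj : j ∈ C
  · have h1 := hin _ (hxR i hi) j hj
    have h2 : ((b j).1 j : ℕ) ≤ (x k).1 j := hbmin j _ (hxR k hk)
    show ((x i).1 j : ℕ) ≤ (x k).1 j + Fintype.card ι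
    omega
  · exact (hout _ (hxR i hi) j hj).trans (Nat.le_add_left _ _)

/-- **Brouwer's fixed point theorem** for the standard simplex. -/
theorem exists_fixedPoint_stdSimplex {ι : Type*} [Fintype ι] [Nonempty ι]
    {f : (ι → ℝ) → ι → ℝ} (hf : ContinuousOn f (stdSimplex ℝ ι))
    (hmaps : MapsTo f (stdSimplex ℝ ι) (stdSimplex ℝ ι)) :
    ∃ x ∈ stdSimplex ℝ ι, f x = x := by
  classical
  have hne : (stdSimplex ℝ ι).Nonempty := ⟨_, single_mem_stdSimplex ℝ (Classical.arbitrary ι)⟩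
  rcases subsingleton_or_nontrivial ι with hι | hι
  · obtain ⟨x, hx⟩ := hne
    refine ⟨x, hx, funext fun i => ?_⟩
    have h1 := (hmaps hx).2
    have h2 := hx.2
    rw [Fintype.sum_subsingleton _ i] at h1 h2
    rw [h1, h2]
  by_contra! hno
  have hpos : ∀ x ∈ stdSimplex ℝ ι, ∃ i, f x i < x i := by
    intro x hx
    by_contra! hle
    refine hno x hx (funext fun i => ?_)
    have hsum : ∑ i, x i = ∑ i, f x i := by rw [hx.2, (hmaps hx).2]
    exact ((Finset.sum_eq_sum_iff_of_le fun i _ => hle i).1 hsum i (Finset.mem_univ i)).symm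
  obtain ⟨ε, hε, hgap⟩ : ∃ ε > 0, ∀ x ∈ stdSimplex ℝ ι, ∃ i, f x i + ε ≤ x i := by
    have hcont : ContinuousOn
        (fun x => Finset.univ.sup' Finset.univ_nonempty fun i => x i - f x i)
        (stdSimplex ℝ ι) :=
      ContinuousOn.finset_sup'_apply _ fun i _ =>
        (continuous_apply i).continuousOn.sub ((continuous_apply i).comp_continuousOn hf)
    obtain ⟨x₀, hx₀, hmin⟩ := (isCompact_stdSimplex ℝ ι).exists_isMinOn hne hcont
    refine ⟨Finset.univ.sup' Finset.univ_nonempty fun i => x₀ i - f x₀ i, ?_, fun x hx => ?_⟩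
    · obtain ⟨i, hi⟩ := hpos x₀ hx₀
      exact (Finset.lt_sup'_iff _).2 ⟨i, Finset.mem_univ i, sub_pos.2 hi⟩
    · obtain ⟨i, -, hi⟩ := (Finset.le_sup'_iff _).1 (isMinOn_iff.1 hmin x hx)
      exact ⟨i, by linarith⟩
  obtain ⟨δ, hδ, hunif⟩ := Metric.uniformContinuousOn_iff.1
    ((isCompact_stdSimplex ℝ ι).uniformContinuousOn_of_continuous hf) (ε / 3) (by positivity)
  set n : ℝ := (Fintype.card ι : ℝ) with hn
  obtain ⟨N, hN⟩ := exists_nat_gt (n / min δ (ε / 3))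
  have hmin : 0 < min δ (ε / 3) := by positivity
  have hn0 : 0 ≤ n := by positivity
  have hN0 : (0 : ℝ) < N := lt_of_le_of_lt (by positivity) hN
  have hnN : n / N < min δ (ε / 3) := by
    rw [div_lt_iff₀ hmin] at hN
    rw [div_lt_iff₀ hN0]; linarith
  have hnδ := hnN.trans_le (min_le_left _ _)
  have hnε := hnN.trans_le (min_le_right _ _)
  let p : (ι → ℕ) → ι → ℝ := fun a i => a i / N
  have hp : ∀ a : ι → ℕ, ∑ i, a i = N → p a ∈ stdSimplex ℝ ι := fun a ha => by
    refine ⟨fun i => by positivity, ?_⟩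
    rw [← Finset.sum_div, ← Nat.cast_sum, ha, div_self hN0.ne']
  have hκ : ∀ a : ι → ℕ, ∃ i, ∑ i, a i = N → p a i ≤ f (p a) i := by
    intro a
    by_contra! hcon
    have ha := (hcon (Classical.arbitrary ι)).1
    have h1 := Finset.sum_lt_sum_of_nonempty Finset.univ_nonempty fun i _ => (hcon i).2
    rw [(hmaps (hp a ha)).2, (hp a ha).2] at h1
    exact lt_irrefl _ h1
  choose κ hκ using hκ
  obtain ⟨C, x, ⟨i₁, hi₁⟩, hx⟩ := exists_rainbow_close N κ
  have hclose : ∀ i ∈ C, ∀ k ∈ C, ∀ j, p (x i) j ≤ p (x k) j + n / N := fun i hi k hk j => by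
    rw [← add_div]
    have : (x i j : ℝ) ≤ x k j + n := by
      rw [hn]
      exact_mod_cast (hx i hi).2.2.2 k hk j
    exact div_le_div_of_nonneg_right this hN0.le
  obtain ⟨i, hi⟩ := hgap _ (hp _ (hx i₁ hi₁).1)
  by_cases hiC : i ∈ C
  · have hd : dist (p (x i)) (p (x i₁)) < δ := by
      rw [dist_pi_lt_iff hδ]
      intro j
      rw [Real.dist_eq, abs_lt]
      constructor <;> linarith [hclose i hiC i₁ hi₁ j, hclose i₁ hi₁ i hiC j]
    have h1 := hunif _ (hp _ (hx i hiC).1) _ (hp _ (hx i₁ hi₁).1) hd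
    have h2 := (dist_le_pi_dist _ _ i).trans_lt h1
    rw [Real.dist_eq, abs_lt] at h2
    have h3 := hκ (x i) (hx i hiC).1
    rw [(hx i hiC).2.1] at h3
    linarith [hclose i₁ hi₁ i hiC i]
  · have h1 : p (x i₁) i ≤ n / N :=
      div_le_div_of_nonneg_right (by rw [hn]; exact_mod_cast (hx i₁ hi₁).2.2.1 i hiC) hN0.le
    linarith [(hmaps (hp _ (hx i₁ hi₁).1)).1 i]

variable {E : Type*} [NormedAddCommGroup E] [NormedSpace ℝ E]

/-- **Brouwer's fixed point theorem** (in Schauder's form) for compact convex sets. -/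
theorem exists_fixedPoint_of_isCompact_of_convex {C : Set E} (hC : IsCompact C)
    (hconv : Convex ℝ C) (hne : C.Nonempty) {h : E → E} (hh : ContinuousOn h C)
    (hmaps : MapsTo h C C) : ∃ x ∈ C, h x = x := by
  classical
  obtain ⟨x₀, hx₀, hmin⟩ := hC.exists_isMinOn hne (f := fun x => dist (h x) x)
    (continuous_dist.comp_continuousOn (hh.prodMk continuousOn_id))
  by_contra! hno
  set ε := dist (h x₀) x₀ with hεdef
  have hε : 0 < ε := dist_pos.2 (hno x₀ hx₀)
  obtain ⟨t, htC, htfin, ht⟩ := hC.finite_cover_balls hε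
  have : Fintype t := htfin.fintype
  have : Nonempty t := by
    obtain ⟨i, hi, -⟩ := mem_iUnion₂.1 (ht hx₀)
    exact ⟨i, hi⟩
  let w : E → t → ℝ := fun x i => max 0 (ε - dist (h x) i)
  have hw0 : ∀ x i, 0 ≤ w x i := fun x i => le_max_left _ _
  have hwpos : ∀ x ∈ C, 0 < ∑ i, w x i := fun x hx => by
    obtain ⟨i, hi, hix⟩ := mem_iUnion₂.1 (ht (hmaps hx))
    exact Finset.sum_pos' (fun i _ => hw0 x i)
      ⟨⟨i, hi⟩, Finset.mem_univ _, lt_max_of_lt_right (sub_pos.2 hix)⟩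
  let π : (t → ℝ) → E := fun l => ∑ i, l i • (i : E)
  have hπ : MapsTo π (stdSimplex ℝ t) C := fun l hl =>
    hconv.sum_mem (fun i _ => hl.1 i) hl.2 fun i _ => htC i.2
  have hπc : Continuous π := by fun_prop
  have hwc : ∀ i, ContinuousOn (fun x => w x i) C := fun i =>
    continuousOn_const.sup (continuousOn_const.sub
      (continuous_dist.comp_continuousOn (hh.prodMk continuousOn_const)))
  obtain ⟨l, hl, hfix⟩ := exists_fixedPoint_stdSimplex
    (f := fun l i => w (π l) i / ∑ j, w (π l) j)
    (continuousOn_pi.2 fun i => ((hwc i).comp hπc.continuousOn hπ).div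
      ((continuousOn_finsetSum _ fun j _ => hwc j).comp hπc.continuousOn hπ)
      fun l hl => (hwpos _ (hπ hl)).ne')
    (fun l hl => ⟨fun i => div_nonneg (hw0 _ i) (hwpos _ (hπ hl)).le, by
      rw [← Finset.sum_div, div_self (hwpos _ (hπ hl)).ne']⟩)
  have hball : π l ∈ Metric.ball (h (π l)) ε := by
    have : ∑ i ∈ Finset.univ.filter fun i => l i ≠ 0, l i • (i : E)
        ∈ Metric.ball (h (π l)) ε := by
      refine (convex_ball _ _).sum_mem (fun i _ => hl.1 i) ?_ fun i hi => ?_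
      · rw [Finset.sum_filter_ne_zero, hl.2]
      · have h0 : w (π l) i ≠ 0 := fun h0 => (Finset.mem_filter.1 hi).2 (by
          rw [← hfix]; simp only [h0, zero_div])
        have h1 : 0 < ε - dist (h (π l)) i := by
          by_contra! hcon
          exact h0 (max_eq_left hcon)
        rw [Metric.mem_ball']
        linarith
    rwa [Finset.sum_filter_of_ne (p := fun i => l i ≠ 0) fun i _ (hi : l i • (i : E) ≠ 0) h0 =>
      hi (by rw [h0, zero_smul])] at this
  exact absurd (hmin (hπ hl)) (not_le.2 (Metric.mem_ball'.1 hball))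

end Brouwer

/-! ### Continuous selections of lower semicontinuous maps -/

section Selection

theorem isOpen_setOf_inter_nonempty {X Y : Type*} [TopologicalSpace X] [TopologicalSpace Y]
    {Φ : X → Set Y} (hlsc : ∀ x, LscAt Φ x) {Ω : Set Y} (hΩ : IsOpen Ω) :
    IsOpen {x | (Φ x ∩ Ω).Nonempty} :=
  isOpen_iff_mem_nhds.2 fun x hx => hlsc x Ω hΩ hx

open Classical in
/-- Shrinking the values of a lower semicontinuous map to an open set, over a closed set, preserves
lower semicontinuity. -/
theorem lscAt_ite_inter {X Y : Type*} [TopologicalSpace X] [TopologicalSpace Y]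
    {Φ : X → Set Y} (hlsc : ∀ x, LscAt Φ x) {A : Set X} (hA : IsClosed A) {B : Set Y}
    (hB : IsOpen B) (x : X) : LscAt (fun x => if x ∈ A then Φ x ∩ B else Φ x) x := by
  intro Ω hΩ hx
  by_cases hxA : x ∈ A
  · simp only [if_pos hxA] at hx
    filter_upwards [hlsc x (B ∩ Ω) (hB.inter hΩ) (by rwa [← inter_assoc])] with x' hx'
    split_ifs
    · rwa [inter_assoc]
    · exact hx'.mono fun y hy => ⟨hy.1, hy.2.2⟩
  · simp only [if_neg hxA] at hx
    filter_upwards [hlsc x Ω hΩ hx, hA.isOpen_compl.mem_nhds hxA] with x' hx' hx'A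
    rwa [if_neg hx'A]

theorem LscAt.inter_ball {X E : Type*} [TopologicalSpace X] [PseudoMetricSpace E]
    {Φ : X → Set E} {x : X} (hlsc : LscAt Φ x) {g : X → E} (hg : ContinuousAt g x) (δ : ℝ) :
    LscAt (fun x => Φ x ∩ Metric.ball (g x) δ) x := by
  rintro Ω hΩ ⟨y, ⟨hy, hyδ⟩, hyΩ⟩
  have hη : 0 < (δ - dist y (g x)) / 2 := half_pos (sub_pos.2 hyδ)
  filter_upwards [hlsc (Ω ∩ Metric.ball y ((δ - dist y (g x)) / 2))
    (hΩ.inter Metric.isOpen_ball) ⟨y, hy, hyΩ, Metric.mem_ball_self hη⟩,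
    Metric.tendsto_nhds.1 hg _ hη] with x' hx' hgx'
  obtain ⟨u, hu, huΩ, huy⟩ := hx'
  refine ⟨u, ⟨hu, ?_⟩, huΩ⟩
  rw [Metric.mem_ball] at huy ⊢
  have h1 := dist_triangle4 u y (g x) (g x')
  rw [dist_comm (g x)] at h1
  linarith

variable {X E : Type*} [NormedAddCommGroup E] [NormedSpace ℝ E]

theorem exists_approximate_selection [TopologicalSpace X] [NormalSpace X] [ParacompactSpace X]
    {Φ : X → Set E} (hlsc : ∀ x, LscAt Φ x) (hne : ∀ x, (Φ x).Nonempty)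
    (hconv : ∀ x, Convex ℝ (Φ x)) {ε : ℝ} (hε : 0 < ε) :
    ∃ g : C(X, E), ∀ x, (Φ x ∩ Metric.ball (g x) ε).Nonempty := by
  obtain ⟨g, hg⟩ := exists_continuous_forall_mem_convex_of_local_const
    (t := fun x => Metric.thickening ε (Φ x)) (fun x => (hconv x).thickening ε) fun x => by
      obtain ⟨y, hy⟩ := hne x
      refine ⟨y, (hlsc x _ Metric.isOpen_ball ⟨y, hy, Metric.mem_ball_self hε⟩).mono ?_⟩
      rintro x' ⟨u, hu, huy⟩
      exact Metric.mem_thickening_iff.2 ⟨u, hu, Metric.mem_ball'.1 huy⟩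
  refine ⟨g, fun x => ?_⟩
  obtain ⟨u, hu, hux⟩ := Metric.mem_thickening_iff.1 (hg x)
  exact ⟨u, hu, Metric.mem_ball'.2 hux⟩

/-- **Michael's selection theorem** on a compact space. -/
theorem exists_continuous_forall_mem_closure [TopologicalSpace X] [CompactSpace X] [NormalSpace X]
    [CompleteSpace E] {Φ : X → Set E} (hlsc : ∀ x, LscAt Φ x) (hne : ∀ x, (Φ x).Nonempty)
    (hconv : ∀ x, Convex ℝ (Φ x)) : ∃ g : C(X, E), ∀ x, g x ∈ closure (Φ x) := by
  let P : ℕ → C(X, E) → Prop := fun n g => ∀ x, (Φ x ∩ Metric.ball (g x) ((1 / 2) ^ n)).Nonempty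
  have hstep : ∀ n g, P n g → ∃ g', P (n + 1) g' ∧ dist g g' ≤ 2 * (1 / 2) ^ n := by
    intro n g hg
    obtain ⟨g', hg'⟩ := exists_approximate_selection
      (Φ := fun x => Φ x ∩ Metric.ball (g x) ((1 / 2) ^ n))
      (fun x => (hlsc x).inter_ball g.continuous.continuousAt _) hg
      (fun x => (hconv x).inter (convex_ball _ _)) (ε := (1 / 2) ^ (n + 1)) (by positivity)
    refine ⟨g', fun x => (hg' x).mono fun u hu => ⟨hu.1.1, hu.2⟩, ?_⟩
    rw [ContinuousMap.dist_le (by positivity)]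
    intro x
    obtain ⟨u, ⟨-, hu⟩, hu'⟩ := hg' x
    have h1 := dist_triangle_left (g x) (g' x) u
    rw [Metric.mem_ball] at hu hu'
    have h2 : ((1 : ℝ) / 2) ^ (n + 1) ≤ (1 / 2) ^ n := by
      rw [pow_succ]; nlinarith [pow_pos (one_half_pos (α := ℝ)) n]
    linarith
  obtain ⟨g₀, hg₀⟩ : ∃ g₀, P 0 g₀ := exists_approximate_selection hlsc hne hconv (by positivity)
  choose! next hnextP hnext using hstep
  let u : ℕ → C(X, E) := fun n => Nat.rec g₀ next n
  have hu : ∀ n, P n (u n) := fun n => by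
    induction n with
    | zero => exact hg₀
    | succ n ih => exact hnextP n _ ih
  obtain ⟨g, hg⟩ := cauchySeq_tendsto_of_complete
    (cauchySeq_of_le_geometric (1 / 2) 2 (by norm_num) fun n => hnext n _ (hu n))
  refine ⟨g, fun x => Metric.mem_closure_iff.2 fun ε hε => ?_⟩
  have h1 := Metric.tendsto_nhds.1 hg (ε / 2) (half_pos hε)
  have h2 := (tendsto_pow_atTop_nhds_zero_of_lt_one (r := (1 / 2 : ℝ)) (by norm_num)
    (by norm_num)).eventually (gt_mem_nhds (half_pos hε))
  obtain ⟨n, hn1, hn2⟩ := (h1.and h2).exists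
  obtain ⟨y, hy, hyn⟩ := hu n x
  refine ⟨y, hy, ?_⟩
  have h3 := dist_triangle_left (g x) y (u n x)
  have h4 := ContinuousMap.dist_apply_le_dist (f := u n) (g := g) x
  rw [Metric.mem_ball'] at hyn
  linarith

/-- Proper separation of a point from a convex set in finite dimension. -/
theorem Convex.exists_forall_le_exists_lt [FiniteDimensional ℝ E] {S : Set E} (hS : Convex ℝ S)
    (hne : S.Nonempty) {z : E} (hz : z ∉ S) :
    ∃ p : E →L[ℝ] ℝ, (∀ y ∈ S, p z ≤ p y) ∧ ∃ y ∈ S, p z < p y := by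
  set T : Set E := (fun x => -z + x) '' S with hT
  set V := Submodule.span ℝ T
  have hTconv : Convex ℝ T := hS.translate (-z)
  set S₀ : Set V := (↑) ⁻¹' T with hS₀
  have hS₀conv : Convex ℝ S₀ := hTconv.linear_preimage V.subtype
  have hspan : Submodule.span ℝ S₀ = ⊤ := Submodule.span_span_coe_preimage
  have hmem : ∀ y ∈ S, ∃ v : V, v ∈ S₀ ∧ (v : E) = -z + y := fun y hy =>
    ⟨⟨-z + y, Submodule.subset_span ⟨y, hy, rfl⟩⟩, ⟨y, hy, rfl⟩, rfl⟩
  set A : Set V := SetLike.coe (ConvexCone.hull ℝ S₀)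
  have hA : Convex ℝ A := (ConvexCone.hull ℝ S₀).convex
  have h0 : (0 : V) ∉ A := by
    intro h
    obtain ⟨c, hc, v, ⟨y, hy, hyv⟩, hv⟩ := (ConvexCone.mem_hull_of_convex hS₀conv).1 h
    rw [smul_eq_zero_iff_right hc.ne'] at hv
    rw [hv] at hyv
    have : y = z := by
      have : -z + y = 0 := hyv
      rwa [neg_add_eq_zero, eq_comm] at this
    exact hz (this ▸ hy)
  have hint : (interior A).Nonempty := by
    rw [hA.interior_nonempty_iff_affineSpan_eq_top]
    obtain ⟨y, hy⟩ := hne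
    obtain ⟨v, hv, -⟩ := hmem y hy
    have hv1 : v ∈ A := ConvexCone.subset_hull hv
    have hv2 : (2 : ℝ) • v ∈ A := (ConvexCone.mem_hull_of_convex hS₀conv).2 ⟨2, two_pos, v, hv, rfl⟩
    have h0A : (0 : V) ∈ affineSpan ℝ A := by
      have := AffineMap.lineMap_mem (2 : ℝ) (subset_affineSpan ℝ A hv2)
        (subset_affineSpan ℝ A hv1)
      convert this using 1
      rw [AffineMap.lineMap_apply_module]
      module
    rw [← affineSpan_insert_eq_affineSpan ℝ h0A, ← AffineSubspace.coe_eq_univ_iff,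
      affineSpan_insert_zero]
    have : Submodule.span ℝ A = ⊤ :=
      top_le_iff.1 (hspan ▸ Submodule.span_mono ConvexCone.subset_hull)
    rw [this, Submodule.top_coe]
  obtain ⟨f, hf, hfA⟩ := geometric_hahn_banach_of_nonempty_interior_point hA
    (fun h => h0 (interior_subset h)) hint
  obtain ⟨q, hq⟩ := LinearMap.exists_extend (-f : V →L[ℝ] ℝ).toLinearMap
  have hqv : ∀ v : V, q v = -f v := fun v => LinearMap.congr_fun hq v
  have hval : ∀ y ∈ S, ∀ v : V, (v : E) = -z + y → q y = q z - f v := fun y _ v hv => by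
    have := hqv v
    rw [hv, map_add, map_neg] at this
    linarith
  have hf0 : ∀ v ∈ S₀, f v ≤ 0 := fun v hv => by
    simpa using hfA v (ConvexCone.subset_hull hv)
  refine ⟨LinearMap.toContinuousLinearMap q, fun y hy => ?_, ?_⟩
  · obtain ⟨v, hv, hvy⟩ := hmem y hy
    have h1 := hval y hy v hvy
    have h2 := hf0 v hv
    show q z ≤ q y
    linarith
  · by_contra! hcon
    refine hf ?_
    have : f.toLinearMap = 0 := LinearMap.ext_on hspan fun v hv => by
      obtain ⟨y, hy, hyv⟩ := hv
      have h1 := hval y hy v hyv.symm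
      have h2 : q y ≤ q z := hcon y hy
      have h3 := hf0 v ⟨y, hy, hyv⟩
      show f v = 0
      linarith
    ext v
    exact LinearMap.congr_fun this v

/-- **Michael's selection theorem** in finite dimension, for convex values that need not be
closed. -/
theorem exists_continuous_forall_mem_of_finiteDimensional [MetricSpace X] [CompactSpace X]
    [FiniteDimensional ℝ E] {Φ : X → Set E} (hlsc : ∀ x, LscAt Φ x) (hne : ∀ x, (Φ x).Nonempty)
    (hconv : ∀ x, Convex ℝ (Φ x)) {M : ℝ} (hM : ∀ x, Φ x ⊆ Metric.closedBall 0 M) :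
    ∃ g : C(X, E), ∀ x, g x ∈ Φ x := by
  classical
  have : CompleteSpace E := FiniteDimensional.complete ℝ E
  have : ProperSpace E := FiniteDimensional.proper ℝ E
  let B : ℕ × ℕ → Set E := fun i =>
    Metric.ball (TopologicalSpace.denseSeq E i.1) (1 / ((i.2 : ℝ) + 1))
  choose A hAc hAU hAeq _hAmono using fun i =>
    (isOpen_setOf_inter_nonempty hlsc (Metric.isOpen_ball : IsOpen (B i))).exists_iUnion_isClosed
  have hsel : ∀ i : (ℕ × ℕ) × ℕ, ∃ g : C(X, E),
      (∀ x, g x ∈ closure (Φ x)) ∧ ∀ x ∈ A i.1 i.2, g x ∈ closure (B i.1) := by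
    intro i
    obtain ⟨g, hg⟩ := exists_continuous_forall_mem_closure
      (lscAt_ite_inter hlsc (hAc i.1 i.2) (Metric.isOpen_ball : IsOpen (B i.1)))
      (fun x => by
        split_ifs with hx
        · exact hAU i.1 i.2 hx
        · exact hne x)
      (fun x => by
        split_ifs
        · exact (hconv x).inter (convex_ball _ _)
        · exact hconv x)
    refine ⟨g, fun x => closure_mono ?_ (hg x), fun x hx => ?_⟩
    · split_ifs
      · exact inter_subset_left
      · exact subset_rfl
    · have := hg x
      rw [if_pos hx] at this
      exact closure_mono inter_subset_right this
  choose g hgΦ hgB using hsel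
  obtain ⟨e, he⟩ := exists_surjective_nat ((ℕ × ℕ) × ℕ)
  let w : ℕ → ℝ := fun k => 1 / 2 / 2 ^ k
  have hw : HasSum w 1 := hasSum_geometric_two' 1
  have hwpos : ∀ k, 0 < w k := fun k => by positivity
  have hbound : ∀ k x, ‖w k • g (e k) x‖ ≤ w k * M := fun k x => by
    have : g (e k) x ∈ Metric.closedBall (0 : E) M :=
      closure_minimal (hM x) Metric.isClosed_closedBall (hgΦ (e k) x)
    rw [norm_smul, Real.norm_of_nonneg (hwpos k).le]
    exact mul_le_mul_of_nonneg_left (mem_closedBall_zero_iff.1 this) (hwpos k).le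
  have hsummable : Summable fun k => w k * M := hw.summable.mul_right M
  refine ⟨⟨fun x => ∑' k, w k • g (e k) x, continuous_tsum
    (fun k => (g (e k)).continuous.const_smul _) hsummable hbound⟩, fun x => ?_⟩
  have hsum : HasSum (fun k => w k • g (e k) x) (∑' k, w k • g (e k) x) :=
    (Summable.of_norm_bounded hsummable fun k => hbound k x).hasSum
  rw [ContinuousMap.coe_mk]
  generalize ∑' k, w k • g (e k) x = z at hsum
  by_contra hz
  obtain ⟨p, hp, y, hy, hpy⟩ := (hconv x).exists_forall_le_exists_lt (hne x) hz
  have hp' : ∀ i, p z ≤ p (g i x) := fun i =>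
    closure_minimal (t := {v | p z ≤ p v}) hp (isClosed_le continuous_const p.continuous)
      (hgΦ i x)
  obtain ⟨q, hzq, hqy⟩ := exists_between hpy
  obtain ⟨ε, hε, hεq⟩ := Metric.isOpen_iff.1
    (isOpen_lt continuous_const p.continuous : IsOpen {v | q < p v}) y hqy
  obtain ⟨m, hm⟩ := exists_nat_one_div_lt (half_pos hε)
  obtain ⟨l, hl⟩ := (TopologicalSpace.denseRange_denseSeq E).exists_dist_lt y
    (Nat.one_div_pos_of_nat (α := ℝ) (n := m))
  have hBq : closure (B (l, m)) ⊆ {v | q ≤ p v} := by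
    refine closure_minimal (fun v hv => ?_) (isClosed_le continuous_const p.continuous)
    suffices hv' : v ∈ Metric.ball y ε from le_of_lt (show q < p v from hεq hv')
    have h1 := dist_triangle_right v y (TopologicalSpace.denseSeq E l)
    have h2 : dist v (TopologicalSpace.denseSeq E l) < 1 / ((m : ℝ) + 1) := hv
    rw [Metric.mem_ball]
    linarith
  have hx : x ∈ ⋃ k, A (l, m) k := by
    rw [hAeq]
    exact ⟨y, hy, hl⟩
  obtain ⟨k, hk⟩ := mem_iUnion.1 hx
  obtain ⟨j, hj⟩ := he ((l, m), k)
  have hlt : p z < p (g (e j) x) := hj ▸ hzq.trans_le (hBq (hgB ((l, m), k) x hk))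
  have hsum₁ : HasSum (fun k => w k * p (g (e k) x)) (p z) := by
    simpa [Function.comp_def] using hsum.mapL p
  have hsum₂ : HasSum (fun k => w k * p z) (p z) := by simpa using hw.mul_right (p z)
  exact lt_irrefl _ (hasSum_lt (fun k => mul_le_mul_of_nonneg_left (hp' (e k)) (hwpos k).le)
    (mul_lt_mul_of_pos_left hlt (hwpos j)) hsum₂ hsum₁)

theorem exists_mem_of_lscAt [FiniteDimensional ℝ E] {C : Set E} (hC : IsCompact C)
    (hCconv : Convex ℝ C) (hCne : C.Nonempty) {Φ : C → Set E} (hlsc : ∀ x, LscAt Φ x)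
    (hne : ∀ x, (Φ x).Nonempty) (hconv : ∀ x, Convex ℝ (Φ x)) (hΦ : ∀ x, Φ x ⊆ C) :
    ∃ x : C, (x : E) ∈ Φ x := by
  classical
  have : CompactSpace C := isCompact_iff_compactSpace.1 hC
  obtain ⟨M, hM⟩ := hC.isBounded.subset_closedBall (0 : E)
  obtain ⟨g, hg⟩ := exists_continuous_forall_mem_of_finiteDimensional hlsc hne hconv
    fun x => (hΦ x).trans hM
  have hext : ∀ x : C, Function.extend Subtype.val g 0 (x : E) = g x := fun x =>
    Subtype.val_injective.extend_apply _ _ x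
  obtain ⟨x, hx, hfix⟩ := exists_fixedPoint_of_isCompact_of_convex hC hCconv hCne
    (h := Function.extend Subtype.val g 0)
    (continuousOn_iff_continuous_domRestrict.2 (by
      have : C.domRestrict (Function.extend Subtype.val g 0) = g := funext hext
      rw [this]; exact g.continuous))
    (fun x hx => by rw [hext ⟨x, hx⟩]; exact hΦ _ (hg ⟨x, hx⟩))
  rw [hext ⟨x, hx⟩] at hfix
  have := hg ⟨x, hx⟩
  rw [hfix] at this
  exact ⟨⟨x, hx⟩, this⟩

end Selection

/-! ### Polytopes are conical at every point -/

section Polytope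

variable {E : Type*} [NormedAddCommGroup E] [NormedSpace ℝ E]

/-- Every element of a finitely generated cone is a nonnegative combination of the generators
with coefficients controlled by its norm. -/
theorem exists_nonneg_combination_sum_le {ι : Type*} (v : ι → E) (s : Finset ι) :
    ∃ c : ℝ, 0 ≤ c ∧ ∀ μ : ι → ℝ, (∀ i ∈ s, 0 ≤ μ i) →
      ∃ ν : ι → ℝ, (∀ i ∈ s, 0 ≤ ν i) ∧ ∑ i ∈ s, ν i • v i = ∑ i ∈ s, μ i • v i ∧
        ∑ i ∈ s, ν i ≤ c * ‖∑ i ∈ s, μ i • v i‖ := by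
  classical
  induction s using Finset.strongInduction with
  | H s ih =>
  by_cases hli : LinearIndepOn ℝ v (s : Set ι)
  · have hker : LinearMap.ker (Fintype.linearCombination ℝ fun i : s => v i) = ⊥ :=
      LinearMap.ker_eq_bot.2 (linearIndependent_iff_injective_fintypeLinearCombination.1 hli)
    obtain ⟨L, -, hL⟩ := LinearMap.exists_antilipschitzWith _ hker
    refine ⟨s.card * L, by positivity, fun μ hμ => ⟨μ, hμ, rfl, ?_⟩⟩
    have h1 := hL.le_mul_dist (fun i : s => μ i) 0
    rw [map_zero, dist_zero_right, dist_zero_right, Fintype.linearCombination_apply,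
      Finset.sum_coe_sort s fun i => μ i • v i] at h1
    calc ∑ i ∈ s, μ i ≤ ∑ _i ∈ s, ‖fun i : s => μ i‖ := Finset.sum_le_sum fun i hi =>
          (le_abs_self _).trans (norm_le_pi_norm (fun i : s => μ i) ⟨i, hi⟩)
      _ = s.card * ‖fun i : s => μ i‖ := by rw [Finset.sum_const, nsmul_eq_mul]
      _ ≤ s.card * (L * ‖∑ i ∈ s, μ i • v i‖) := by gcongr
      _ = _ := by ring
  · obtain ⟨f, hf, hpos⟩ : ∃ f : ι → ℝ, ∑ i ∈ s, f i • v i = 0 ∧ ∃ i ∈ s, 0 < f i := by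
      obtain ⟨f, hf, i, hi, hfi⟩ := not_linearIndepOn_finset_iff.1 hli
      rcases hfi.lt_or_gt with h | h
      · exact ⟨-f, by simp [hf], i, hi, neg_pos.2 h⟩
      · exact ⟨f, hf, i, hi, h⟩
    choose! c hc0 hc using fun i (hi : i ∈ s) => ih (s.erase i) (Finset.erase_ssubset hi)
    refine ⟨∑ i ∈ s, c i, Finset.sum_nonneg hc0, fun μ hμ => ?_⟩
    obtain ⟨j, hj, hmin⟩ := Finset.exists_min_image (s.filter fun i => 0 < f i)
      (fun i => μ i / f i) (by simpa [Finset.Nonempty] using hpos)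
    obtain ⟨hjs, hfj⟩ := Finset.mem_filter.1 hj
    have hθ : 0 ≤ μ j / f j := div_nonneg (hμ j hjs) hfj.le
    have hμ' : ∀ i ∈ s, 0 ≤ μ i - μ j / f j * f i := fun i hi => by
      rcases le_or_gt (f i) 0 with h | h
      · linarith [hμ i hi, mul_nonpos_of_nonneg_of_nonpos hθ h]
      · exact sub_nonneg.2 ((le_div_iff₀ h).1 (hmin i (Finset.mem_filter.2 ⟨hi, h⟩)))
    obtain ⟨ν, hν0, hνeq, hν⟩ := hc j hjs (fun i => μ i - μ j / f j * f i)
      fun i hi => hμ' i (Finset.mem_of_mem_erase hi)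
    have heq : ∑ i ∈ s.erase j, (μ i - μ j / f j * f i) • v i = ∑ i ∈ s, μ i • v i := by
      rw [Finset.sum_erase _ (by rw [div_mul_cancel₀ _ hfj.ne', sub_self, zero_smul])]
      simp_rw [sub_smul, mul_smul, Finset.sum_sub_distrib, ← Finset.smul_sum, hf, smul_zero,
        sub_zero]
    rw [heq] at hνeq hν
    have hupd : ∀ i ∈ s.erase j, Function.update ν j 0 i = ν i := fun i hi =>
      Function.update_of_ne (Finset.ne_of_mem_erase hi) _ _
    refine ⟨Function.update ν j 0, fun i hi => ?_, ?_, ?_⟩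
    · rcases eq_or_ne i j with rfl | h
      · rw [Function.update_self]
      · rw [hupd i (Finset.mem_erase.2 ⟨h, hi⟩)]
        exact hν0 i (Finset.mem_erase.2 ⟨h, hi⟩)
    · rw [← hνeq, ← Finset.sum_erase s (a := j) (by rw [Function.update_self, zero_smul])]
      exact Finset.sum_congr rfl fun i hi => by rw [hupd i hi]
    · rw [← Finset.sum_erase s (a := j) (Function.update_self _ _ _), Finset.sum_congr rfl hupd]
      exact hν.trans (mul_le_mul_of_nonneg_right (Finset.single_le_sum hc0 hjs) (norm_nonneg _))

/-- A convex set containing a point `y` together with points in the directions of all vertices of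
a polytope contains a neighborhood of `y` in the polytope, of size independent of the set. -/
theorem exists_convexHull_inter_ball_subset (s : Finset E) (y : E) {t : ℝ} (ht : 0 < t) :
    ∃ δ > 0, ∀ H : Set E, Convex ℝ H → y ∈ H → (∀ i ∈ s, y + t • (i - y) ∈ H) →
      convexHull ℝ (s : Set E) ∩ Metric.ball y δ ⊆ H := by
  obtain ⟨c, hc0, hc⟩ := exists_nonneg_combination_sum_le (fun i => i - y) s
  refine ⟨t / (c + 1), by positivity, fun H hH hy hsH z ⟨hz, hzy⟩ => ?_⟩
  obtain ⟨μ, hμ0, hμ1, rfl⟩ := Finset.mem_convexHull'.1 hz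
  obtain ⟨ν, hν0, hνeq, hν⟩ := hc μ hμ0
  have hsub : ∑ i ∈ s, μ i • (i - y) = ∑ i ∈ s, μ i • i - y := by
    simp_rw [smul_sub, Finset.sum_sub_distrib, ← Finset.sum_smul, hμ1, one_smul]
  rw [hsub] at hνeq hν
  rw [mem_ball_iff_norm, lt_div_iff₀ (by positivity)] at hzy
  have hνt : ∑ i ∈ s, ν i / t ≤ 1 := by
    rw [← Finset.sum_div, div_le_one ht]
    nlinarith [norm_nonneg (∑ i ∈ s, μ i • i - y)]
  have hmem := hH.sum_mem (t := Finset.insertNone s)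
    (w := fun o => o.elim (1 - ∑ i ∈ s, ν i / t) fun i => ν i / t)
    (z := fun o => o.elim y fun i => y + t • (i - y))
    (by
      rintro (_ | i) hi
      · exact sub_nonneg.2 hνt
      · exact div_nonneg (hν0 i (Finset.some_mem_insertNone.1 hi)) ht.le)
    (by simp)
    (by
      rintro (_ | i) hi
      · exact hy
      · exact hsH i (Finset.some_mem_insertNone.1 hi))
  convert hmem using 1
  simp only [Finset.sum_insertNone, Option.elim_none, Option.elim_some, smul_add, smul_smul,
    div_mul_cancel₀ _ ht.ne', Finset.sum_add_distrib, hνeq, ← Finset.sum_smul]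
  module

theorem exists_isOpen_eventually_subset {s : Finset E} {S : Set (convexHull ℝ (s : Set E))}
    {F : convexHull ℝ (s : Set E) → Set (convexHull ℝ (s : Set E))}
    (hFconv : ∀ x ∈ S, Convex ℝ (Subtype.val '' F x)) {x : convexHull ℝ (s : Set E)}
    (hFsec : ∀ y ∈ F x, ∀ᶠ x' in 𝓝[S] x, y ∈ F x') (hopen : IsOpen (F x))
    {y : convexHull ℝ (s : Set E)} (hy : y ∈ F x) :
    ∃ W : Set (convexHull ℝ (s : Set E)), IsOpen W ∧ y ∈ W ∧ ∀ᶠ x' in 𝓝[S] x, W ⊆ F x' := by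
  obtain ⟨O, hO, hOF⟩ := isOpen_induced_iff.1 hopen
  have hyO : (y : E) ∈ O := by rwa [← hOF] at hy
  have hsmall : ∀ᶠ t : ℝ in 𝓝[>] 0, ∀ i ∈ s, (y : E) + t • (i - y) ∈ O := by
    refine (Finset.eventually_all s).2 fun i _ => ?_
    have : Tendsto (fun t : ℝ => (y : E) + t • (i - y)) (𝓝 0) (𝓝 y) := by
      have : Continuous fun t : ℝ => (y : E) + t • (i - (y : E)) := by fun_prop
      simpa using this.tendsto 0
    exact (this.mono_left nhdsWithin_le_nhds) (hO.mem_nhds hyO)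
  obtain ⟨t, htO, ht0, ht1⟩ := (hsmall.and (Ioo_mem_nhdsGT one_pos)).exists
  obtain ⟨δ, hδ, hball⟩ := exists_convexHull_inter_ball_subset s (y : E) ht0
  have hmem : ∀ i ∈ s, (y : E) + t • (i - y) ∈ convexHull ℝ (s : Set E) := fun i hi =>
    (convex_convexHull ℝ _).add_smul_sub_mem y.2 (subset_convexHull ℝ _ hi) ⟨ht0.le, ht1.le⟩
  have hev : ∀ᶠ x' in 𝓝[S] x, ∀ i : s,
      (⟨y + t • ((i : E) - y), hmem i i.2⟩ : convexHull ℝ (s : Set E)) ∈ F x' :=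
    eventually_all.2 fun i => hFsec _ (hOF ▸ show _ ∈ O from htO i i.2)
  refine ⟨Metric.ball y δ, Metric.isOpen_ball, Metric.mem_ball_self hδ, ?_⟩
  filter_upwards [hev, hFsec y hy, self_mem_nhdsWithin] with x' hx' hyx' hx'S z hz
  obtain ⟨z', hz', hzz'⟩ := hball _ (hFconv x' hx'S) ⟨y, hyx', rfl⟩
    (fun i hi => ⟨_, hx' ⟨i, hi⟩, rfl⟩) ⟨z.2, hz⟩
  rwa [← Subtype.ext hzz']

end Polytope

theorem LscAt.image {X Y Z : Type*} [TopologicalSpace X] [TopologicalSpace Y] [TopologicalSpace Z]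
    {Φ : X → Set Y} {x : X} (h : LscAt Φ x) {g : Y → Z} (hg : Continuous g) :
    LscAt (fun x => g '' Φ x) x := by
  intro Ω hΩ hx
  simp only [image_inter_nonempty_iff] at hx ⊢
  exact h _ (hΩ.preimage hg) hx

/-- Gluing lower semicontinuous maps along the boundary of a closed set. -/
theorem lscAt_setOf_glue {X Y : Type*} [TopologicalSpace X] [TopologicalSpace Y] {S : Set X}
    (hS : IsClosed S) {F K : X → Set Y} {x : X} (hK : LscAt K x)
    (hFsec : x ∈ S → ∀ y ∈ F x, ∀ᶠ x' in 𝓝[S] x, y ∈ F x')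
    (hF : x ∈ frontier S → ∀ y ∈ F x, ∃ W, IsOpen W ∧ y ∈ W ∧ ∀ᶠ x' in 𝓝[S] x, W ⊆ F x') :
    LscAt (fun x => {y | (x ∈ S → y ∈ F x) ∧ (x ∉ interior S → y ∈ K x)}) x := by
  rintro Ω hΩ ⟨y, ⟨hyF, hyK⟩, hyΩ⟩
  by_cases hxS : x ∈ S
  · by_cases hxi : x ∈ interior S
    · filter_upwards [eventually_nhdsWithin_iff.1 (hFsec hxS y (hyF hxS)),
        isOpen_interior.mem_nhds hxi] with x' hx' hx'i
      exact ⟨y, ⟨hx', fun h => absurd hx'i h⟩, hyΩ⟩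
    · obtain ⟨W, hW, hyW, hWF⟩ := hF ⟨subset_closure hxS, hxi⟩ y (hyF hxS)
      filter_upwards [eventually_nhdsWithin_iff.1 hWF,
        hK (Ω ∩ W) (hΩ.inter hW) ⟨y, hyK hxi, hyΩ, hyW⟩] with x' hx' ⟨u, huK, huΩ, huW⟩
      exact ⟨u, ⟨fun h => hx' h huW, fun _ => huK⟩, huΩ⟩
  · filter_upwards [hS.isOpen_compl.mem_nhds hxS,
      hK Ω hΩ ⟨y, hyK fun h => hxS (interior_subset h), hyΩ⟩] with x' hx' ⟨u, huK, huΩ⟩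
    exact ⟨u, ⟨fun h => absurd h hx', fun _ => huK⟩, huΩ⟩

/-- Theorem 3.3: existence for the quasiequilibrium problem when `C` is a (nonempty)
polytope, i.e. the convex hull of a finite set: `K` lower semicontinuous with nonempty
convex values and closed fixed point set, `F x := {y ∈ C : f x y < 0}` convex-valued on
`fix K`, with lower sections open in the relative topology of `fix K`, and with values
open in the relative topology of `C` at every point of `∂_C fix K`. -/
theorem quasiequilibrium_existence_polytope {n : ℕ} {C : Set (Fin n → ℝ)}
    (s : Set (Fin n → ℝ)) (hs : s.Finite) (hsne : s.Nonempty)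
    (hC : C = convexHull ℝ s)
    (f : C → C → ℝ) (hdiag : ∀ x : C, f x x = 0)
    (K : C → Set C)
    (hKlsc : ∀ x : C, LscAt K x)
    (hKne : ∀ x : C, (K x).Nonempty)
    (hKconv : ∀ x : C, Convex ℝ (Subtype.val '' K x))
    (hfix : IsClosed {x : C | x ∈ K x})
    (F : C → Set C) (hF : ∀ x : C, F x = {y : C | f x y < 0})
    (hFconv : ∀ x ∈ {x : C | x ∈ K x}, Convex ℝ (Subtype.val '' F x))
    (hFsec : ∀ y : C,
      IsOpen ((fun z : {x : C | x ∈ K x} => (z : C)) ⁻¹' {x : C | y ∈ F x}))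
    (hFopen : ∀ x ∈ frontier {x : C | x ∈ K x}, IsOpen (F x)) :
    ∃ x : C, x ∈ K x ∧ ∀ y ∈ K x, 0 ≤ f x y := by
  lift s to Finset (Fin n → ℝ) using hs
  subst hC
  by_contra! hcon
  set S : Set (convexHull ℝ (s : Set (Fin n → ℝ))) := {x | x ∈ K x} with hS
  have hsec : ∀ x ∈ S, ∀ y ∈ F x, ∀ᶠ x' in 𝓝[S] x, y ∈ F x' := fun x hx y hy =>
    preimage_coe_mem_nhds_subtype.1 ((hFsec y).mem_nhds (show (⟨x, hx⟩ : S) ∈ _ from hy))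
  obtain ⟨x, hx⟩ := exists_mem_of_lscAt (s.finite_toSet.isCompact_convexHull (𝕜 := ℝ))
    (convex_convexHull ℝ _) hsne.convexHull
    (Φ := fun x => Subtype.val '' {y | (x ∈ S → y ∈ F x) ∧ (x ∉ interior S → y ∈ K x)})
    (fun x => (lscAt_setOf_glue hfix (hKlsc x) (hsec x) fun hx y hy =>
      exists_isOpen_eventually_subset hFconv (hsec x (hfix.frontier_subset hx))
        (hFopen x hx) hy).image continuous_subtype_val)
    (fun x => by
      refine Nonempty.image _ ?_
      by_cases hx : x ∈ S
      · obtain ⟨y, hyK, hy⟩ := hcon x hx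
        exact ⟨y, fun _ => hF x ▸ hy, fun _ => hyK⟩
      · obtain ⟨y, hy⟩ := hKne x
        exact ⟨y, fun h => absurd h hx, fun _ => hy⟩)
    (fun x => by
      rw [ofPred_and, image_inter Subtype.val_injective]
      by_cases hx : x ∈ S <;> by_cases hxi : x ∈ interior S
      · simpa [hx, hxi] using (hFconv x hx).inter (convex_convexHull ℝ (s : Set (Fin n → ℝ)))
      · simpa [hx, hxi] using (hFconv x hx).inter (hKconv x)
      · exact absurd (interior_subset hxi) hx
      · simpa [hx, hxi] using (convex_convexHull ℝ (s : Set (Fin n → ℝ))).inter (hKconv x))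
    (fun x => Subtype.coe_image_subset _ _)
  obtain ⟨y, ⟨hyF, hyK⟩, hyx⟩ := hx
  obtain rfl := Subtype.ext hyx
  by_cases hy : y ∈ S
  · have := hyF hy
    rw [hF] at this
    exact (hdiag y).not_lt this
  · exact hy (hyK fun h => hy (interior_subset h))
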